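/- Let A be an invertible real d×d matrix, Λ = Aℤ^d, and let Γ = {γ ∈ ℝ^d : ⟨λ, γ⟩ ∈ ℤ for all λ ∈ Λ} = (Aᵀ)⁻¹ℤ^d be the annihilator lattice of Λ. Let ℓ be a positive integer and let Ω ⊆ ℝ^d be a bounded Lebesgue measurable set with |Ω| > 0 such that ∑_{γ∈Γ} 1_Ω(ω+γ) ≤ ℓ for almost every ω ∈ ℝ^d and {ω ∈ ℝ^d : ∑_{γ∈Γ} 1_Ω(ω+γ) = ℓ} has positive Lebesgue measure (i.e. (Ω, Γ) is an ℓ-subtiling pair). Then there exist a₁, …, a_ℓ ∈ ℝ^d such that the family of exponentials {x ↦ e^{2πi⟨a_j+λ, x⟩} restricted to Ω : 1 ≤ j ≤ ℓ, λ ∈ Λ} is a frame of L²(Ω). -/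

import Mathlib

open MeasureTheory ENNReal

/-- A family `φ i : α → ℂ` of functions is a frame for `L²(μ)` with frame bounds `A ≤ B`. -/
def IsFrameWith {α : Type*} [MeasurableSpace α] (μ : Measure α) {I : Type*}
    (φ : I → α → ℂ) (A B : ℝ) : Prop :=
  ∀ f : Lp ℂ 2 μ,
    A * ‖f‖ ^ 2 ≤ (∑' i : I, ‖∫ x, f x * (starRingEnd ℂ) (φ i x) ∂μ‖ ^ 2) ∧
    (∑' i : I, ‖∫ x, f x * (starRingEnd ℂ) (φ i x) ∂μ‖ ^ 2) ≤ B * ‖f‖ ^ 2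

/-- A family is a frame for `L²(μ)` if it has some frame bounds `0 < A ≤ B`. -/
def IsFrame {α : Type*} [MeasurableSpace α] (μ : Measure α) {I : Type*}
    (φ : I → α → ℂ) : Prop :=
  ∃ A B : ℝ, 0 < A ∧ A ≤ B ∧ IsFrameWith μ φ A B

/-- The lattice `A ℤ^d` in `ℝ^d`, for an invertible `d × d` real matrix `A`. -/
def latticeOf (d : ℕ) (A : Matrix (Fin d) (Fin d) ℝ) : Set (Fin d → ℝ) :=
  {v | ∃ k : Fin d → ℤ, v = A.mulVec fun i => (k i : ℝ)}

/-- The annihilator lattice `Γ = {γ : ⟨λ, γ⟩ ∈ ℤ for all λ ∈ A ℤ^d}` of the lattice `A ℤ^d`. -/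
def annihilatorOf (d : ℕ) (A : Matrix (Fin d) (Fin d) ℝ) : Set (Fin d → ℝ) :=
  {γ | ∀ v ∈ latticeOf d A, ∃ n : ℤ, (∑ i, v i * γ i) = (n : ℝ)}

/-- The exponential `x ↦ e^{2πi⟨b, x⟩}` on `ℝ^d`. -/
noncomputable def expChar {d : ℕ} (b : Fin d → ℝ) : (Fin d → ℝ) → ℂ :=
  fun x => Complex.exp (2 * Real.pi * Complex.I * (∑ i, b i * x i))

/-- The half-open unit box `(0, 1]^d`. -/
def unitBox (d : ℕ) : Set (Fin d → ℝ) := {x | ∀ i, x i ∈ Set.Ioc (0 : ℝ) 1}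

lemma measurableSet_unitBox (d : ℕ) : MeasurableSet (unitBox d) :=
  MeasurableSet.univ_pi' fun _ => measurableSet_Ioc

lemma mFourier_coe {d : ℕ} (k : Fin d → ℤ) (x : Fin d → ℝ) :
    UnitAddTorus.mFourier k (fun i => (x i : UnitAddCircle)) = expChar (fun i => (k i : ℝ)) x := by
  simp only [UnitAddTorus.mFourier, ContinuousMap.coe_mk, fourier_coe_apply, expChar]
  rw [← Complex.exp_sum]
  congr 1
  push_cast
  rw [Finset.mul_sum]
  exact Finset.sum_congr rfl fun i _ => by ring

lemma hasSum_sq_integral_unitBox {d : ℕ} {h : (Fin d → ℝ) → ℂ}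
    (hh : MemLp h 2 (volume.restrict (unitBox d))) :
    HasSum (fun k : Fin d → ℤ =>
        ‖∫ y in unitBox d, h y * (starRingEnd ℂ) (expChar (fun i => (k i : ℝ)) y)‖ ^ 2)
      (∫ y in unitBox d, ‖h y‖ ^ 2) := by
  have hD : {x : Fin d → ℝ | ∀ i, x i ∈ Set.Ioc ((fun _ => (0 : ℝ)) i) ((fun _ => (0 : ℝ)) i + 1)}
      = unitBox d := by
    simp [unitBox]
  set s := UnitAddTorus.measurableEquivPiIoc (fun _ : Fin d => (0 : ℝ)) with hs
  set H : UnitAddTorus (Fin d) → ℂ := fun t => h (s t).1 with hH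
  have hmp := (measurePreserving_subtype_coe (μa := (volume : Measure (Fin d → ℝ)))
      (MeasurableSet.univ_pi' fun _ => measurableSet_Ioc)).comp
    (UnitAddTorus.measurePreserving_equivPiIoc (fun _ : Fin d => (0 : ℝ)))
  have hHL := MemLp.comp_measurePreserving (hD.symm ▸ hh) hmp
  have key := UnitAddTorus.hasSum_sq_mFourierCoeff (MemLp.toLp _ hHL)
  have hae := MemLp.coeFn_toLp hHL
  have hHs : ∀ y ∈ unitBox d, H (fun i => (y i : UnitAddCircle)) = h y := by
    intro y hy
    rw [← hD] at hy
    have := s.apply_symm_apply ⟨y, hy⟩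
    simp only [hH]
    rw [hs, UnitAddTorus.coe_symm_measurableEquivPiIoc_apply] at this
    rw [hs, this]
  convert! key using 1
  · funext k
    congr 2
    have : UnitAddTorus.mFourierCoeff (MemLp.toLp _ hHL) k = UnitAddTorus.mFourierCoeff H k := by
      refine integral_congr_ae ?_
      filter_upwards [hae] with t ht
      rw [ht]; rfl
    rw [this, UnitAddTorus.mFourierCoeff_eq_integral _ _ (fun _ => 0), hD]
    refine setIntegral_congr_fun (measurableSet_unitBox d) fun y hy => ?_
    rw [hHs y hy, UnitAddTorus.mFourier_neg, mFourier_coe, smul_eq_mul, mul_comm]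
  · have h2 : ∫ t, ‖MemLp.toLp _ hHL t‖ ^ 2 ∂(Measure.pi fun _ => AddCircle.haarAddCircle)
        = ∫ t, ‖H t‖ ^ 2 ∂(Measure.pi fun _ => AddCircle.haarAddCircle) := by
      refine integral_congr_ae ?_
      filter_upwards [hae] with t ht
      rw [ht]; rfl
    refine Eq.trans ?_ h2.symm
    refine Eq.trans ?_ (UnitAddTorus.integral_preimage (fun t => ‖H t‖ ^ 2) (fun _ => 0)).symm
    rw [hD]
    refine setIntegral_congr_fun (measurableSet_unitBox d) fun y hy => ?_
    rw [hHs y hy]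

lemma integral_eq_integral_unitBox_sum {d : ℕ} {E : Type*} [NormedAddCommGroup E]
    [NormedSpace ℝ E] {g : (Fin d → ℝ) → E} (hg : Integrable g) (G : Finset (Fin d → ℤ))
    (hG : ∀ y, g y ≠ 0 → (fun i => ⌈y i⌉ - 1) ∈ G) :
    ∫ y, g y = ∫ y in unitBox d, ∑ n ∈ G, g (y + fun i => (n i : ℝ)) := by
  classical
  let D : (Fin d → ℤ) → Set (Fin d → ℝ) := fun n => {y | (y - fun i => (n i : ℝ)) ∈ unitBox d}
  have hDm : ∀ n, MeasurableSet (D n) := fun n =>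
    (measurable_id.sub_const _) (measurableSet_unitBox d)
  have hmem : ∀ n y, y ∈ D n ↔ n = fun i => ⌈y i⌉ - 1 := by
    intro n y
    simp only [D, unitBox, Set.mem_ofPred_eq, Pi.sub_apply, Set.mem_Ioc, funext_iff]
    refine forall_congr' fun i => ?_
    rw [eq_sub_iff_add_eq, eq_comm, Int.ceil_eq_iff]
    push_cast
    constructor <;> rintro ⟨h1, h2⟩ <;> constructor <;> linarith
  have hsum : ∀ y, g y = ∑ n ∈ G, (D n).indicator g y := by
    intro y
    simp only [Set.indicator_apply, hmem]
    rw [Finset.sum_ite_eq']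
    by_cases h : g y = 0
    · simp [h]
    · rw [if_pos (hG y h)]
  calc ∫ y, g y = ∫ y, ∑ n ∈ G, (D n).indicator g y := integral_congr_ae (.of_forall hsum)
    _ = ∑ n ∈ G, ∫ y, (D n).indicator g y :=
        integral_finsetSum _ fun n _ => hg.indicator (hDm n)
    _ = ∑ n ∈ G, ∫ y in unitBox d, g (y + fun i => (n i : ℝ)) := by
        refine Finset.sum_congr rfl fun n _ => ?_
        rw [← integral_add_right_eq_self _ (fun i => (n i : ℝ)),
          ← integral_indicator (measurableSet_unitBox d)]
        refine integral_congr_ae (.of_forall fun y => ?_)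
        simp [Set.indicator_apply, D]
    _ = _ := (integral_finsetSum _ fun n _ => (hg.comp_add_right _).integrableOn).symm

/-- A frequency separating the points of a finite set of integer vectors modulo `ℤ`. -/
lemma exists_injOn_expChar {d : ℕ} (G : Finset (Fin d → ℤ)) :
    ∃ b : Fin d → ℝ, Set.InjOn (fun n : Fin d → ℤ => expChar b (fun i => (n i : ℝ))) G := by
  classical
  let P : Finset ((Fin d → ℤ) × (Fin d → ℤ)) := G.offDiag
  obtain ⟨f, hf⟩ := Module.exists_dual_forall_apply_ne_zero (K := ℝ) (M := Fin d → ℝ)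
    (fun p : P => fun i => ((p.1.1 i - p.1.2 i : ℤ) : ℝ)) (by
      rintro ⟨⟨m, n⟩, hp⟩ h0
      refine (Finset.mem_offDiag.1 hp).2.2 (funext fun i => ?_)
      have := congrFun h0 i
      simp only [Pi.zero_apply, Int.cast_eq_zero] at this
      exact sub_eq_zero.1 this)
  let C : ℝ := 1 + ∑ p ∈ P, |f fun i => ((p.1 i - p.2 i : ℤ) : ℝ)|
  have hC : 0 < C := by positivity
  have hfb : ∀ x : Fin d → ℝ, f x = ∑ i, f (Pi.single i 1) * x i := by
    intro x
    conv_lhs => rw [pi_eq_sum_univ' x]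
    simp [mul_comm]
  refine ⟨fun i => C⁻¹ * f (Pi.single i 1), fun m hm n hn hmn => ?_⟩
  by_contra hne
  have hp : (m, n) ∈ P := Finset.mem_offDiag.2 ⟨hm, hn, hne⟩
  have h1 : f (fun i => ((m i - n i : ℤ) : ℝ)) ≠ 0 := hf ⟨(m, n), hp⟩
  have h2 : |f fun i => ((m i - n i : ℤ) : ℝ)| < C := by
    have := Finset.single_le_sum (f := fun p : (Fin d → ℤ) × (Fin d → ℤ) =>
      |f fun i => ((p.1 i - p.2 i : ℤ) : ℝ)|) (fun _ _ => abs_nonneg _) hp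
    simp only [C] at this ⊢
    linarith
  simp only [expChar] at hmn
  obtain ⟨k, hk⟩ := Complex.exp_eq_exp_iff_exists_int.1 hmn
  have hpi : (2 * Real.pi * Complex.I : ℂ) ≠ 0 := by simp [Real.pi_ne_zero]
  have h3 : (∑ i, C⁻¹ * f (Pi.single i 1) * (m i : ℝ))
      = (∑ i, C⁻¹ * f (Pi.single i 1) * (n i : ℝ)) + k := by
    have : (2 * Real.pi * Complex.I : ℂ) * ((∑ i, C⁻¹ * f (Pi.single i 1) * (m i : ℝ) : ℝ) : ℂ)
      = (2 * Real.pi * Complex.I : ℂ) *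
        (((∑ i, C⁻¹ * f (Pi.single i 1) * (n i : ℝ)) + k : ℝ) : ℂ) := by
      push_cast at hk ⊢
      rw [hk]; ring
    exact_mod_cast mul_left_cancel₀ hpi this
  have h4 : f (fun i => ((m i - n i : ℤ) : ℝ)) = C * k := by
    rw [hfb]
    simp only [mul_assoc, ← Finset.mul_sum] at h3
    push_cast
    simp only [mul_sub, Finset.sum_sub_distrib]
    field_simp at h3
    linarith
  rw [h4] at h1 h2
  have hk0 : k ≠ 0 := by rintro rfl; simp at h1
  rw [abs_mul, abs_of_pos hC] at h2
  have : (1 : ℝ) ≤ |(k : ℝ)| := by exact_mod_cast Int.one_le_abs hk0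
  nlinarith

lemma eq_zero_of_forall_sum_pow_mul_eq_zero {ι : Type*} {G : Finset ι} {z : ι → ℂ}
    (hz : Set.InjOn z G) {ℓ : ℕ} {u : ι → ℂ}
    (hcard : (G.filter fun n => u n ≠ 0).card ≤ ℓ)
    (h : ∀ j < ℓ, ∑ n ∈ G, z n ^ j * u n = 0) : ∀ n ∈ G, u n = 0 := by
  classical
  set S := G.filter fun n => u n ≠ 0 with hS
  let e := S.equivFin.symm
  have key := Matrix.eq_zero_of_forall_pow_sum_mul_pow_eq_zero
    (f := fun i : Fin S.card => z (e i)) (v := fun i => u (e i))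
    (fun i j hij => e.injective (Subtype.ext
      (hz (Finset.mem_filter.1 (e i).2).1 (Finset.mem_filter.1 (e j).2).1 hij)))
    (fun j => by
      rw [Equiv.sum_comp e (fun n : S => u n * z n ^ (j : ℕ)),
        Finset.sum_coe_sort S (fun n => u n * z n ^ (j : ℕ)),
        ← h j (j.2.trans_le hcard), Finset.sum_filter]
      refine Finset.sum_congr rfl fun n _ => ?_
      by_cases hn : u n = 0 <;> simp [hn, mul_comm])
  intro n hn
  by_contra hne
  have hnS : n ∈ S := Finset.mem_filter.2 ⟨hn, hne⟩
  have := congrFun key (e.symm ⟨n, hnS⟩)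
  simp at this
  exact hne this

lemma exists_pos_mul_sum_sq_le {ι : Type*} {G : Finset ι} {z : ι → ℂ}
    (hz : Set.InjOn z G) (ℓ : ℕ) :
    ∃ c : ℝ, 0 < c ∧ ∀ u : ι → ℂ, (G.filter fun n => u n ≠ 0).card ≤ ℓ →
      c * ∑ n ∈ G, ‖u n‖ ^ 2 ≤ ∑ j : Fin ℓ, ‖∑ n ∈ G, z n ^ (j : ℕ) * u n‖ ^ 2 := by
  classical
  have main : ∀ S ∈ G.powerset, ∃ c : ℝ, 0 < c ∧ (S.card ≤ ℓ → ∀ u : ι → ℂ,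
      c * ∑ n ∈ S, ‖u n‖ ^ 2 ≤ ∑ j : Fin ℓ, ‖∑ n ∈ S, z n ^ (j : ℕ) * u n‖ ^ 2) := by
    intro S hS
    by_cases hc : S.card ≤ ℓ
    swap
    · exact ⟨1, one_pos, fun h => absurd h hc⟩
    let L : EuclideanSpace ℂ S →ₗ[ℂ] EuclideanSpace ℂ (Fin ℓ) :=
      Matrix.toLpLin 2 2 (Matrix.of fun (j : Fin ℓ) (n : S) => z n ^ (j : ℕ))
    have hL : ∀ u j, L u j = ∑ n : S, z n ^ (j : ℕ) * u n := by
      intro u j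
      simp [L, Matrix.toLpLin_apply, Matrix.mulVec, dotProduct]
    have hinj : LinearMap.ker L = ⊥ := by
      rw [LinearMap.ker_eq_bot']
      intro u hu
      have := eq_zero_of_forall_sum_pow_mul_eq_zero (G := (Finset.univ : Finset S))
        (z := fun n : S => z n) (u := u) (ℓ := ℓ)
        (fun m _ n _ hmn => Subtype.ext (hz (Finset.mem_powerset.1 hS m.2)
          (Finset.mem_powerset.1 hS n.2) hmn))
        ((Finset.card_filter_le _ _).trans (by simpa using hc))
        (fun j hj => by rw [← hL u ⟨j, hj⟩, hu]; rfl)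
      ext n
      exact this n (Finset.mem_univ n)
    obtain ⟨K, hK, hanti⟩ := L.exists_antilipschitzWith hinj
    refine ⟨((K : ℝ) ^ 2)⁻¹, by positivity, fun _ u => ?_⟩
    have h1 := hanti.le_mul_norm_sub (x := WithLp.toLp 2 (fun n : S => u n)) (y := 0)
    rw [map_zero, add_zero, add_zero, norm_neg, norm_neg] at h1
    have h2 : ‖WithLp.toLp 2 (fun n : S => u n)‖ ^ 2
        ≤ (K : ℝ) ^ 2 * ‖L (WithLp.toLp 2 (fun n : S => u n))‖ ^ 2 := by
      rw [← mul_pow]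
      exact pow_le_pow_left₀ (norm_nonneg _) h1 2
    rw [EuclideanSpace.norm_sq_eq, EuclideanSpace.norm_sq_eq] at h2
    simp only [hL] at h2
    rw [Finset.sum_coe_sort S (fun n => ‖u n‖ ^ 2)] at h2
    have h3 : ∀ j : Fin ℓ, ∑ n : S, z n ^ (j : ℕ) * u n = ∑ n ∈ S, z n ^ (j : ℕ) * u n :=
      fun j => Finset.sum_coe_sort S (fun n => z n ^ (j : ℕ) * u n)
    simp only [h3] at h2
    rw [inv_mul_le_iff₀ (by positivity)]
    exact h2
  choose! c hc0 hc using main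
  have hne : G.powerset.Nonempty := ⟨∅, by simp⟩
  refine ⟨G.powerset.inf' hne c, ?_, fun u hu => ?_⟩
  · exact (Finset.lt_inf'_iff _).2 hc0
  · set S := G.filter fun n => u n ≠ 0 with hS
    have hSG : S ∈ G.powerset := Finset.mem_powerset.2 (Finset.filter_subset _ _)
    have h1 : ∑ n ∈ G, ‖u n‖ ^ 2 = ∑ n ∈ S, ‖u n‖ ^ 2 := by
      rw [hS, Finset.sum_filter]
      refine Finset.sum_congr rfl fun n _ => ?_
      by_cases hn : u n = 0 <;> simp [hn]
    have h2 : ∀ j : Fin ℓ, ∑ n ∈ G, z n ^ (j : ℕ) * u n = ∑ n ∈ S, z n ^ (j : ℕ) * u n := by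
      intro j
      rw [hS, Finset.sum_filter]
      refine Finset.sum_congr rfl fun n _ => ?_
      by_cases hn : u n = 0 <;> simp [hn]
    simp only [h1, h2]
    refine le_trans ?_ (hc S hSG hu u)
    exact mul_le_mul_of_nonneg_right (Finset.inf'_le _ hSG) (by positivity)

lemma sum_sq_norm_sum_pow_mul_le {ι : Type*} (G : Finset ι) {z : ι → ℂ}
    (hz : ∀ n, ‖z n‖ = 1) (ℓ : ℕ) (u : ι → ℂ) :
    ∑ j : Fin ℓ, ‖∑ n ∈ G, z n ^ (j : ℕ) * u n‖ ^ 2 ≤ ℓ * G.card * ∑ n ∈ G, ‖u n‖ ^ 2 := by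
  have : ∀ j : Fin ℓ, ‖∑ n ∈ G, z n ^ (j : ℕ) * u n‖ ^ 2 ≤ G.card * ∑ n ∈ G, ‖u n‖ ^ 2 := by
    intro j
    refine le_trans (pow_le_pow_left₀ (norm_nonneg _) (norm_sum_le _ _) 2) ?_
    simp only [norm_mul, norm_pow, hz, one_pow, one_mul]
    exact sq_sum_le_card_mul_sum_sq
  refine (Finset.sum_le_sum fun j _ => this j).trans ?_
  simp [mul_assoc]

lemma norm_expChar {d : ℕ} (b x : Fin d → ℝ) : ‖expChar b x‖ = 1 := by
  have : (2 * Real.pi * Complex.I * (∑ i, b i * x i) : ℂ)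
      = ((2 * Real.pi * ∑ i, b i * x i : ℝ) : ℂ) * Complex.I := by
    push_cast; ring
  rw [expChar, this, Complex.norm_exp_ofReal_mul_I]

lemma continuous_expChar {d : ℕ} (b : Fin d → ℝ) : Continuous (expChar b) := by
  unfold expChar
  fun_prop

lemma expChar_add_left {d : ℕ} (a b x : Fin d → ℝ) :
    expChar (a + b) x = expChar a x * expChar b x := by
  simp only [expChar, ← Complex.exp_add, Pi.add_apply]
  congr 1
  push_cast
  simp only [add_mul, Finset.sum_add_distrib, mul_add]

lemma expChar_add_right {d : ℕ} (b x y : Fin d → ℝ) :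
    expChar b (x + y) = expChar b x * expChar b y := by
  simp only [expChar, ← Complex.exp_add, Pi.add_apply]
  congr 1
  push_cast
  simp only [Finset.sum_add_distrib, mul_add]

lemma expChar_nsmul {d : ℕ} (j : ℕ) (b x : Fin d → ℝ) :
    expChar (j • b) x = expChar b x ^ j := by
  simp only [expChar, ← Complex.exp_nat_mul, Pi.smul_apply, nsmul_eq_mul]
  congr 1
  push_cast
  simp only [Finset.mul_sum]
  exact Finset.sum_congr rfl fun i _ => by ring

lemma expChar_intCast {d : ℕ} (k n : Fin d → ℤ) :
    expChar (fun i => (k i : ℝ)) (fun i => (n i : ℝ)) = 1 := by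
  rw [expChar, Complex.exp_eq_one_iff]
  exact ⟨∑ i, k i * n i, by push_cast; ring⟩

lemma MeasureTheory.MemLp.mul_conj_expChar {d : ℕ} {g : (Fin d → ℝ) → ℂ} {p : ℝ≥0∞}
    {μ : Measure (Fin d → ℝ)} (hg : MemLp g p μ) (b : Fin d → ℝ) :
    MemLp (fun y => g y * (starRingEnd ℂ) (expChar b y)) p μ := by
  refine hg.of_le (hg.1.mul ?_) (.of_forall fun y => ?_)
  · exact (Complex.continuous_conj.comp (continuous_expChar b)).aestronglyMeasurable
  · simp [norm_expChar]

/-- Parseval's identity for the Fourier transform, sampled at the integers, of a square integrable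
function supported over finitely many integer translates of the unit box. -/
lemma hasSum_sq_integral_mul_conj_expChar {d : ℕ} {g : (Fin d → ℝ) → ℂ} (hg : Integrable g)
    (hg2 : MemLp g 2) (G : Finset (Fin d → ℤ))
    (hG : ∀ y, g y ≠ 0 → (fun i => ⌈y i⌉ - 1) ∈ G) :
    HasSum (fun k : Fin d → ℤ =>
        ‖∫ y, g y * (starRingEnd ℂ) (expChar (fun i => (k i : ℝ)) y)‖ ^ 2)
      (∫ y in unitBox d, ‖∑ n ∈ G, g (y + fun i => (n i : ℝ))‖ ^ 2) := by
  have hL : MemLp (fun y => ∑ n ∈ G, g (y + fun i => (n i : ℝ))) 2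
      (volume.restrict (unitBox d)) :=
    (memLp_finsetSum G fun n _ => hg2.comp_measurePreserving
      (measurePreserving_add_right volume fun i => (n i : ℝ))).restrict _
  convert hasSum_sq_integral_unitBox hL using 4 with k
  rw [integral_eq_integral_unitBox_sum (memLp_one_iff_integrable.1
    ((memLp_one_iff_integrable.2 hg).mul_conj_expChar _)) G
    (fun y hy => hG y (left_ne_zero_of_mul hy))]
  simp only [expChar_add_right, expChar_intCast, mul_one, Finset.sum_mul]

open scoped Classical in
lemma exists_frame_bounds_of_card_le {d ℓ : ℕ} {Ω : Set (Fin d → ℝ)}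
    (hΩ : Bornology.IsBounded Ω)
    (hcard : ∀ᵐ y : Fin d → ℝ, ∀ G : Finset (Fin d → ℤ),
      (G.filter fun n => (y + fun i => (n i : ℝ)) ∈ Ω).card ≤ ℓ) :
    ∃ (b : Fin d → ℝ) (c C : ℝ), 0 < c ∧ c ≤ C ∧ ∀ g : (Fin d → ℝ) → ℂ, MemLp g 2 →
      (∀ y, g y ≠ 0 → y ∈ Ω) →
      c * ∫ y, ‖g y‖ ^ 2 ≤ (∑' p : Fin ℓ × (Fin d → ℤ), ‖∫ y, g y * (starRingEnd ℂ)
        (expChar ((p.1 : ℕ) • b + fun i => (p.2 i : ℝ)) y)‖ ^ 2) ∧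
      (∑' p : Fin ℓ × (Fin d → ℤ), ‖∫ y, g y * (starRingEnd ℂ)
        (expChar ((p.1 : ℕ) • b + fun i => (p.2 i : ℝ)) y)‖ ^ 2) ≤ C * ∫ y, ‖g y‖ ^ 2 := by
  obtain ⟨R, hR⟩ := hΩ.subset_closedBall 0
  let G : Finset (Fin d → ℤ) := Fintype.piFinset fun _ => Finset.Icc (⌈-R⌉ - 1) (⌈R⌉ - 1)
  have hG : ∀ y ∈ Ω, (fun i => ⌈y i⌉ - 1) ∈ G := by
    intro y hy
    have h1 : ‖y‖ ≤ R := by simpa using hR hy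
    refine Fintype.mem_piFinset.2 fun i => Finset.mem_Icc.2 ?_
    have h2 := abs_le.1 ((norm_le_pi_norm y i).trans h1)
    exact ⟨sub_le_sub_right (Int.ceil_mono h2.1) 1, sub_le_sub_right (Int.ceil_mono h2.2) 1⟩
  obtain ⟨b, hb⟩ := exists_injOn_expChar G
  let z : (Fin d → ℤ) → ℂ := fun n => (starRingEnd ℂ) (expChar b fun i => (n i : ℝ))
  have hz : Set.InjOn z G := fun m hm n hn hmn => hb hm hn ((starRingEnd ℂ).injective hmn)
  have hz1 : ∀ n, ‖z n‖ = 1 := fun n => by simp [z, norm_expChar]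
  obtain ⟨c, hc, hlow⟩ := exists_pos_mul_sum_sq_le hz ℓ
  refine ⟨b, c, max c (ℓ * G.card), hc, le_max_left _ _, fun g hg hgΩ => ?_⟩
  have hgi : Integrable g := by
    rw [← integrableOn_iff_integrable_of_support_subset
      (s := Metric.closedBall 0 R) fun y hy => hR (hgΩ y hy)]
    have : IsFiniteMeasure (volume.restrict (Metric.closedBall (0 : Fin d → ℝ) R)) :=
      ⟨by simpa using measure_closedBall_lt_top⟩
    exact (hg.restrict _).integrable (by norm_num)
  have hgG : ∀ y, g y ≠ 0 → (fun i => ⌈y i⌉ - 1) ∈ G := fun y hy => hG y (hgΩ y hy)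
  let F : Fin ℓ → (Fin d → ℝ) → ℝ := fun j y =>
    ‖∑ n ∈ G, z n ^ (j : ℕ) * g (y + fun i => (n i : ℝ))‖ ^ 2
  have hsum : ∀ j : Fin ℓ, HasSum (fun k : Fin d → ℤ => ‖∫ y, g y * (starRingEnd ℂ)
      (expChar ((j : ℕ) • b + fun i => (k i : ℝ)) y)‖ ^ 2) (∫ y in unitBox d, F j y) := by
    intro j
    convert hasSum_sq_integral_mul_conj_expChar (memLp_one_iff_integrable.1
      ((memLp_one_iff_integrable.2 hgi).mul_conj_expChar ((j : ℕ) • b)))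
      (hg.mul_conj_expChar ((j : ℕ) • b)) G (fun y hy => hgG y (left_ne_zero_of_mul hy)) using 4
    · simp only [expChar_add_left, map_mul, mul_assoc]
    · rename_i y
      have : ∀ n : Fin d → ℤ, g (y + fun i => (n i : ℝ)) *
          (starRingEnd ℂ) (expChar ((j : ℕ) • b) (y + fun i => (n i : ℝ)))
          = (starRingEnd ℂ) (expChar ((j : ℕ) • b) y) *
            (z n ^ (j : ℕ) * g (y + fun i => (n i : ℝ))) := by
        intro n
        rw [expChar_add_right, expChar_nsmul _ _ (fun i => (n i : ℝ)), map_mul, map_pow]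
        ring
      simp only [this, ← Finset.mul_sum, norm_mul, RCLike.norm_conj, norm_expChar, one_mul]
  have hshift : ∀ n : Fin d → ℤ, MemLp (fun y => g (y + fun i => (n i : ℝ))) 2 := fun n =>
    hg.comp_measurePreserving (measurePreserving_add_right volume fun i => (n i : ℝ))
  have integrable_sq : ∀ {h : (Fin d → ℝ) → ℂ}, MemLp h 2 → Integrable fun y => ‖h y‖ ^ 2 :=
    fun hh => (memLp_two_iff_integrable_sq_norm hh.1).1 hh
  have hFi : ∀ j, IntegrableOn (F j) (unitBox d) := fun j =>
    (integrable_sq (memLp_finsetSum G fun n _ =>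
      (hshift n).const_mul (z n ^ (j : ℕ)))).integrableOn
  have htsum : (∑' p : Fin ℓ × (Fin d → ℤ), ‖∫ y, g y * (starRingEnd ℂ)
      (expChar ((p.1 : ℕ) • b + fun i => (p.2 i : ℝ)) y)‖ ^ 2)
      = ∫ y in unitBox d, ∑ j, F j y := by
    have hs : ∀ j : Fin ℓ, Summable fun k : Fin d → ℤ => ‖∫ y, g y * (starRingEnd ℂ)
        (expChar ((j : ℕ) • b + fun i => (k i : ℝ)) y)‖ ^ 2 := fun j => (hsum j).summable
    have hs' : Summable fun p : Fin ℓ × (Fin d → ℤ) => ‖∫ y, g y * (starRingEnd ℂ)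
        (expChar ((p.1 : ℕ) • b + fun i => (p.2 i : ℝ)) y)‖ ^ 2 :=
      (summable_prod_of_nonneg fun _ => sq_nonneg _).2 ⟨hs, Summable.of_finite⟩
    rw [hs'.tsum_prod' hs, tsum_fintype, integral_finsetSum _ fun j _ => hFi j]
    exact Finset.sum_congr rfl fun j _ => (hsum j).tsum_eq
  have hnorm : ∫ y, ‖g y‖ ^ 2
      = ∫ y in unitBox d, ∑ n ∈ G, ‖g (y + fun i => (n i : ℝ))‖ ^ 2 :=
    integral_eq_integral_unitBox_sum (integrable_sq hg) G
      fun y hy => hgG y (by simpa using hy)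
  have hi1 : IntegrableOn (fun y => ∑ n ∈ G, ‖g (y + fun i => (n i : ℝ))‖ ^ 2) (unitBox d) :=
    (integrable_finsetSum G fun n _ =>
      integrable_sq (hshift n)).integrableOn
  have hi2 : IntegrableOn (fun y => ∑ j, F j y) (unitBox d) :=
    integrable_finsetSum _ fun j _ => hFi j
  rw [htsum]
  constructor
  · rw [hnorm, ← integral_const_mul]
    refine integral_mono_ae (hi1.const_mul c) hi2 ?_
    filter_upwards [ae_restrict_of_ae hcard] with y hy
    refine hlow (fun n => g (y + fun i => (n i : ℝ))) (le_trans ?_ (hy G))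
    exact Finset.card_le_card (Finset.monotone_filter_right G fun n _ hn => hgΩ _ hn)
  · refine le_trans ?_ (mul_le_mul_of_nonneg_right (le_max_right c (ℓ * G.card))
      (integral_nonneg fun y => by positivity))
    rw [hnorm, ← integral_const_mul]
    exact integral_mono hi2 (hi1.const_mul _) fun y =>
      sum_sq_norm_sum_pow_mul_le G hz1 ℓ fun n => g (y + fun i => (n i : ℝ))

lemma tsum_prod_latticeOf {d : ℕ} {A : Matrix (Fin d) (Fin d) ℝ} (hA : IsUnit A.det) {ι : Type*}
    (F : ι × (Fin d → ℝ) → ℝ) :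
    ∑' p : ι × latticeOf d A, F (p.1, p.2)
      = ∑' p : ι × (Fin d → ℤ), F (p.1, A.mulVec fun i => (p.2 i : ℝ)) := by
  have hinj : Function.Injective fun k : Fin d → ℤ =>
      (⟨A.mulVec fun i => (k i : ℝ), k, rfl⟩ : latticeOf d A) := by
    intro k m hkm
    have h := Matrix.mulVec_injective_of_isUnit ((Matrix.isUnit_iff_isUnit_det A).2 hA)
      (Subtype.ext_iff.1 hkm)
    funext i
    exact_mod_cast congrFun h i
  let e : (Fin d → ℤ) ≃ latticeOf d A := Equiv.ofBijective _
    ⟨hinj, fun v => v.2.imp fun k hk => Subtype.ext hk.symm⟩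
  exact ((Equiv.prodCongr (Equiv.refl ι) e).tsum_eq
    fun p : ι × latticeOf d A => F (p.1, p.2)).symm

lemma dotProduct_mulVec_mulVec_transpose_inv {d : ℕ} {A : Matrix (Fin d) (Fin d) ℝ}
    (hA : IsUnit A.det) (v y : Fin d → ℝ) :
    ∑ i, A.mulVec v i * A.transpose⁻¹.mulVec y i = ∑ i, v i * y i := by
  change A.mulVec v ⬝ᵥ A.transpose⁻¹.mulVec y = v ⬝ᵥ y
  rw [Matrix.dotProduct_mulVec, ← Matrix.mulVec_transpose, Matrix.mulVec_mulVec,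
    Matrix.transpose_nonsing_inv, Matrix.transpose_transpose, Matrix.nonsing_inv_mul A hA,
    Matrix.one_mulVec]

open scoped Classical in
/-- A point has at most `ℓ` translates by `Γ` in `Ω` if its covering number is at most `ℓ`. -/
lemma card_filter_translates_le {d ℓ : ℕ} {A : Matrix (Fin d) (Fin d) ℝ} (hA : IsUnit A.det)
    {Ω : Set (Fin d → ℝ)} {y : Fin d → ℝ}
    (h : (∑' γ : annihilatorOf d A, Ω.indicator (fun _ => (1 : ℝ≥0∞))
      (A.transpose⁻¹.mulVec y + (γ : Fin d → ℝ))) ≤ (ℓ : ℝ≥0∞)) (G : Finset (Fin d → ℤ)) :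
    (G.filter fun n => A.transpose⁻¹.mulVec (y + fun i => (n i : ℝ)) ∈ Ω).card ≤ ℓ := by
  have hmem : ∀ n : Fin d → ℤ,
      A.transpose⁻¹.mulVec (fun i => (n i : ℝ)) ∈ annihilatorOf d A := by
    rintro n _ ⟨k, rfl⟩
    exact ⟨∑ i, k i * n i, by rw [dotProduct_mulVec_mulVec_transpose_inv hA]; push_cast; rfl⟩
  let e : (Fin d → ℤ) ↪ annihilatorOf d A :=
    ⟨fun n => ⟨_, hmem n⟩, fun m n hmn => by
      have h1 := Matrix.mulVec_injective_of_isUnit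
        ((Matrix.isUnit_iff_isUnit_det _).2 (Matrix.isUnit_nonsing_inv_det _
          (by rwa [Matrix.det_transpose]))) (Subtype.ext_iff.1 hmn)
      funext i
      exact_mod_cast congrFun h1 i⟩
  have h2 := (ENNReal.sum_le_tsum (G.map e)).trans h
  rw [Finset.sum_map] at h2
  have h3 : ∀ n : Fin d → ℤ, Ω.indicator (fun _ => (1 : ℝ≥0∞))
      (A.transpose⁻¹.mulVec y + (e n : Fin d → ℝ))
      = if A.transpose⁻¹.mulVec (y + fun i => (n i : ℝ)) ∈ Ω then 1 else 0 := by
    intro n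
    rw [Matrix.mulVec_add, Set.indicator_apply]
    rfl
  simp only [h3, Finset.sum_boole] at h2
  exact_mod_cast h2

/-- If `Ω ⊆ ℝ^d` is a bounded measurable set of positive measure and `(Ω, Γ)` is an
`ℓ`-subtiling pair for the annihilator `Γ` of the lattice `Λ = A ℤ^d`, then there exist
`a₁, …, a_ℓ ∈ ℝ^d` such that the exponentials `e^{2πi⟨a_j + λ, ·⟩}`, `λ ∈ Λ`, form a frame
of `L²(Ω)`. -/
theorem subtiling_implies_frame_of_exponentials_Rd
    (d : ℕ) (A : Matrix (Fin d) (Fin d) ℝ) (hA : IsUnit A.det)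
    (Ω : Set (Fin d → ℝ)) (hΩmeas : MeasurableSet Ω)
    (hΩbdd : Bornology.IsBounded Ω) (hΩpos : 0 < volume Ω)
    (ℓ : ℕ) (hℓ : 0 < ℓ)
    (hsub : ∀ᵐ ω : Fin d → ℝ, (∑' γ : annihilatorOf d A,
        Ω.indicator (fun _ => (1 : ℝ≥0∞)) (ω + (γ : Fin d → ℝ))) ≤ (ℓ : ℝ≥0∞))
    (hsup : 0 < volume {ω : Fin d → ℝ | (∑' γ : annihilatorOf d A,
        Ω.indicator (fun _ => (1 : ℝ≥0∞)) (ω + (γ : Fin d → ℝ))) = (ℓ : ℝ≥0∞)}) :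
    ∃ a : Fin ℓ → (Fin d → ℝ), IsFrame (volume.restrict Ω)
      (fun p : Fin ℓ × latticeOf d A => expChar (a p.1 + (p.2 : Fin d → ℝ))) := by
  classical
  set M := A.transpose⁻¹ with hM
  have hMu : IsUnit M.det := Matrix.isUnit_nonsing_inv_det _ (by rwa [Matrix.det_transpose])
  have hMM : M * M⁻¹ = 1 := Matrix.mul_nonsing_inv M hMu
  have hMM' : M⁻¹ * M = 1 := Matrix.nonsing_inv_mul M hMu
  let T : (Fin d → ℝ) ≃L[ℝ] (Fin d → ℝ) :=
    (Matrix.toLin'OfInv hMM' hMM).toContinuousLinearEquiv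
  have hTM : ⇑T = ⇑(Matrix.toLin' M) := by
    funext y
    simp only [T, LinearEquiv.coe_toContinuousLinearEquiv']
    rfl
  have hT : ∀ y, T y = M.mulVec y := fun y => by rw [hTM, Matrix.toLin'_apply]
  have hTe : MeasurableEmbedding T := T.toHomeomorph.measurableEmbedding
  set κ : ℝ := |M.det⁻¹| with hκ
  have hκ0 : 0 < κ := abs_pos.2 (inv_ne_zero hMu.ne_zero)
  have hmap : Measure.map T volume = ENNReal.ofReal κ • volume := by
    rw [hTM]
    exact Real.map_matrix_volume_pi_eq_smul_volume_pi hMu.ne_zero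
  have hint : ∀ {E : Type} [NormedAddCommGroup E] [NormedSpace ℝ E] (F : (Fin d → ℝ) → E),
      ∫ y, F (T y) = κ • ∫ x, F x := by
    intro E _ _ F
    rw [← hTe.integral_map, hmap, integral_smul_measure, ENNReal.toReal_ofReal hκ0.le]
  have hcard : ∀ᵐ y : Fin d → ℝ, ∀ G : Finset (Fin d → ℤ),
      (G.filter fun n => (y + fun i => (n i : ℝ)) ∈ T ⁻¹' Ω).card ≤ ℓ := by
    have hq : Measure.QuasiMeasurePreserving T volume volume :=
      ⟨hTe.measurable, hmap ▸ Measure.smul_absolutelyContinuous⟩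
    filter_upwards [hq.ae hsub] with y hy
    rw [hT] at hy
    simpa only [Set.mem_preimage, hT] using card_filter_translates_le hA hy
  obtain ⟨b, c, C, hc, hcC, hbounds⟩ :=
    exists_frame_bounds_of_card_le (T.antilipschitz.isBounded_preimage hΩbdd) hcard
  refine ⟨fun j => A.mulVec ((j : ℕ) • b), κ⁻¹ * c, κ⁻¹ * C, by positivity,
    mul_le_mul_of_nonneg_left hcC (by positivity), fun f => ?_⟩
  have hf0 : MemLp (Ω.indicator f) 2 volume :=
    (memLp_indicator_iff_restrict hΩmeas).2 (Lp.memLp f)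
  have hg : MemLp (fun y => Ω.indicator f (T y)) 2 := by
    have : MemLp (Ω.indicator f) 2 (Measure.map T volume) :=
      hmap ▸ hf0.smul_measure ENNReal.ofReal_ne_top
    exact (hTe.memLp_map_measure_iff).1 this
  have hnorm : ∫ y, ‖Ω.indicator f (T y)‖ ^ 2 = κ * ‖f‖ ^ 2 := by
    rw [hint fun x => ‖Ω.indicator f x‖ ^ 2, smul_eq_mul, ← inner_self_eq_norm_sq (𝕜 := ℂ) f,
      L2.inner_def, ← integral_re (L2.integrable_inner f f), ← integral_indicator hΩmeas]
    congr 2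
    funext x
    by_cases hx : x ∈ Ω
    · simp only [Set.indicator_of_mem hx, inner_self_eq_norm_sq]
    · simp [Set.indicator_of_notMem hx]
  have hcoef : ∀ v : Fin d → ℝ,
      ‖∫ x, f x * (starRingEnd ℂ) (expChar (A.mulVec v) x) ∂(volume.restrict Ω)‖ ^ 2
      = (κ⁻¹) ^ 2 * ‖∫ y, Ω.indicator f (T y) * (starRingEnd ℂ) (expChar v y)‖ ^ 2 := by
    intro v
    have h1 : ∀ y, expChar v y = expChar (A.mulVec v) (T y) := by
      intro y
      have := dotProduct_mulVec_mulVec_transpose_inv hA v y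
      simp only [expChar, hT, hM, this]
    simp only [h1]
    rw [hint fun x => Ω.indicator f x * (starRingEnd ℂ) (expChar (A.mulVec v) x), norm_smul,
      Real.norm_of_nonneg hκ0.le, ← integral_indicator hΩmeas, mul_pow, ← mul_assoc, ← mul_pow,
      inv_mul_cancel₀ hκ0.ne', one_pow, one_mul]
    simp only [Set.indicator_mul_left]
  have htsum : (∑' p : Fin ℓ × latticeOf d A, ‖∫ x, f x * (starRingEnd ℂ)
      (expChar (A.mulVec ((p.1 : ℕ) • b) + (p.2 : Fin d → ℝ)) x) ∂(volume.restrict Ω)‖ ^ 2)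
      = (κ⁻¹) ^ 2 * ∑' p : Fin ℓ × (Fin d → ℤ), ‖∫ y, Ω.indicator f (T y) *
        (starRingEnd ℂ) (expChar ((p.1 : ℕ) • b + fun i => (p.2 i : ℝ)) y)‖ ^ 2 := by
    rw [tsum_prod_latticeOf hA (fun q : Fin ℓ × (Fin d → ℝ) => ‖∫ x, f x * (starRingEnd ℂ)
      (expChar (A.mulVec ((q.1 : ℕ) • b) + q.2) x) ∂(volume.restrict Ω)‖ ^ 2), ← tsum_mul_left]
    simp only [← Matrix.mulVec_add, hcoef]
  obtain ⟨hlow, hup⟩ := hbounds _ hg fun y hy => Set.mem_preimage.2 (Set.mem_of_indicator_ne_zero hy)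
  rw [hnorm] at hlow hup
  rw [htsum]
  have hscale : ∀ t : ℝ, κ⁻¹ * t * ‖f‖ ^ 2 = (κ⁻¹) ^ 2 * (t * (κ * ‖f‖ ^ 2)) := by
    intro t
    field_simp
  rw [hscale, hscale]
  exact ⟨mul_le_mul_of_nonneg_left hlow (by positivity),
    mul_le_mul_of_nonneg_left hup (by positivity)⟩
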